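/- Let V be a finite-dimensional complex vector space and φ ∈ End(V) with Jordan decomposition φ = s + n (s diagonalizable, n nilpotent, sn = ns). Then for every t ∈ ℂ with t ≠ 0, the endomorphism s + t·n is conjugate to φ under GL(V). Consequently s lies in the closure of the GL(V)-orbit of φ. -/

import Mathlib

open Polynomial in
lemma piece_aux (t : ℂ) (ht : t ≠ 0) (p : ℂ[X]) (hp : Irreducible p) (e : ℕ) :
    ∃ (l : ℂ) (σ : (ℂ[X] ⧸ Submodule.span ℂ[X] {p ^ e}) ≃ₗ[ℂ] (ℂ[X] ⧸ Submodule.span ℂ[X] {p ^ e})),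
      (∀ x, σ ((X : ℂ[X]) • x) = (C t * X + C (l - t * l)) • σ x) ∧
      ∀ x : ℂ[X] ⧸ Submodule.span ℂ[X] {p ^ e}, ((X - C l : ℂ[X]) ^ e) • x = 0 := by
  obtain ⟨l, hl⟩ := IsAlgClosed.exists_root p (ne_of_gt (hp.degree_pos))
  have hdvd : (X - C l) ∣ p := dvd_iff_isRoot.2 hl
  have hass : Associated (X - C l) p := (irreducible_X_sub_C l).associated_of_dvd hp hdvd
  have hI : Submodule.span ℂ[X] {p ^ e} = Ideal.span {(X - C l) ^ e} :=
    (Ideal.span_singleton_eq_span_singleton.2 (hass.pow_pow (n := e))).symm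
  rw [hI]
  let _ : Invertible t := invertibleOfNonzero ht
  let f := algEquivCMulXAddC t (l - t * l)
  have hfX : f X = C t * X + C (l - t * l) := by simp [f, algEquivCMulXAddC]
  have hf : f (X - C l) = C t * (X - C l) := by
    rw [map_sub, hfX, show f (C l) = C l from f.commutes l]
    simp only [C_sub, C_mul]; ring
  have hmap : Ideal.span {(X - C l : ℂ[X]) ^ e} = Ideal.map (f : ℂ[X] →+* ℂ[X]) (Ideal.span {(X - C l : ℂ[X]) ^ e}) := by
    rw [Ideal.map_span, Set.image_singleton]
    apply Ideal.span_singleton_eq_span_singleton.2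
    have : (f : ℂ[X] →+* ℂ[X]) ((X - C l) ^ e) = (C t * (X - C l)) ^ e := by
      rw [map_pow]; congr 1
    rw [this]
    apply Associated.pow_pow
    exact (associated_unit_mul_left _ _ (isUnit_C.2 ht.isUnit)).symm
  refine ⟨l, (Ideal.quotientEquivAlg _ _ f hmap).toLinearEquiv, ?_, ?_⟩
  · intro x
    obtain ⟨x, rfl⟩ := Ideal.Quotient.mk_surjective x
    change Ideal.Quotient.mk _ (f (X * x)) = Ideal.Quotient.mk _ (_ * f x)
    rw [map_mul, hfX]
  · intro x
    obtain ⟨x, rfl⟩ := Ideal.Quotient.mk_surjective x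
    change Ideal.Quotient.mk _ (_ * x) = 0
    rw [Ideal.Quotient.eq_zero_iff_mem]
    exact Ideal.mul_mem_right _ _ (Ideal.mem_span_singleton_self _)

open Polynomial in
lemma conj_aux {V : Type} [AddCommGroup V] [Module ℂ V] [FiniteDimensional ℂ V]
    (f s n : Module.End ℂ V) (hf : f = s + n)
    (hs : ∀ (l : ℂ) (N : ℕ) (v : V), ((f - algebraMap ℂ (Module.End ℂ V) l) ^ N) v = 0 → s v = l • v)
    (t : ℂ) (ht : t ≠ 0) : ∃ g : V ≃ₗ[ℂ] V, ∀ v, g (f v) = (s + t • n) (g v) := by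
  classical
  obtain ⟨ι, _, p, hp, e, ⟨E⟩⟩ := Module.equiv_directSum_of_isTorsion
    (Module.AEval.isTorsion_of_finiteDimensional ℂ V f)
  choose l σ h1 h2 using fun i => piece_aux t ht (p i) (hp i) (e i)
  let E' : V ≃ₗ[ℂ] _ := (Module.AEval.of ℂ V f) ≪≫ₗ E.restrictScalars ℂ
  have hE : ∀ (q : ℂ[X]) x, E'.symm (q • x) = aeval f q (E'.symm x) := by
    intro q x
    change (Module.AEval.of ℂ V f).symm (E.symm (q • x)) = _
    rw [map_smul, Module.AEval.of_symm_smul]; rfl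
  obtain ⟨SS, hS⟩ : ∃ SS : (DirectSum ι fun i => ℂ[X] ⧸ Submodule.span ℂ[X] {p i ^ e i}) ≃ₗ[ℂ]
      (DirectSum ι fun i => ℂ[X] ⧸ Submodule.span ℂ[X] {p i ^ e i}),
      ∀ i z, SS (DirectSum.lof ℂ[X] ι _ i z) = DirectSum.lof ℂ[X] ι _ i (σ i z) :=
    ⟨DFinsupp.mapRange.linearEquiv σ, fun i z =>
      DFinsupp.mapRange_single (hf := fun i => map_zero (σ i))⟩
  clear_value E'
  let g : V ≃ₗ[ℂ] V := E' ≪≫ₗ SS ≪≫ₗ E'.symm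
  refine ⟨g, fun v => ?_⟩
  obtain ⟨y, rfl⟩ := E'.symm.surjective v
  have hfX : ∀ x, f (E'.symm x) = E'.symm ((X : ℂ[X]) • x) := by
    intro x; rw [hE]; simp
  have hg : ∀ x, g (E'.symm x) = E'.symm (SS x) := by
    intro x; simp [g]
  rw [hfX, hg, hg]
  induction y using DirectSum.induction_on with
  | zero => simp
  | add x y hx hy => rw [smul_add, map_add, map_add, map_add, map_add, map_add, hx, hy]
  | of i x =>
    rw [← DirectSum.lof_eq_of ℂ[X]]
    rw [← map_smul, hS, hS, h1, map_smul, hE]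
    set w := E'.symm (DirectSum.lof ℂ[X] ι _ i (σ i x)) with hw
    have hsw : s w = l i • w := by
      apply hs (l i) (e i)
      have := hE ((X - C (l i)) ^ e i) (DirectSum.lof ℂ[X] ι _ i (σ i x))
      rw [← map_smul, h2, map_zero, map_zero] at this
      simpa using this.symm
    have hnw : f w = l i • w + n w := by rw [hf, LinearMap.add_apply, hsw]
    simp [hsw, hnw, Module.algebraMap_end_apply]
    module

lemma diag_aux (d : ℕ) (s n : Matrix (Fin d) (Fin d) ℂ)
    (hs : ∃ g : (Matrix (Fin d) (Fin d) ℂ)ˣ, ∃ D : Fin d → ℂ,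
      s = (g : Matrix (Fin d) (Fin d) ℂ) * Matrix.diagonal D *
        ((g⁻¹ : (Matrix (Fin d) (Fin d) ℂ)ˣ) : Matrix (Fin d) (Fin d) ℂ))
    (hn : IsNilpotent n) (hc : s * n = n * s) (l : ℂ) (N : ℕ) (v : Fin d → ℂ)
    (h : ((s + n - algebraMap ℂ _ l) ^ N).mulVec v = 0) : s.mulVec v = l • v := by
  obtain ⟨k, hk⟩ := hn
  have hcl : ∀ a : Matrix (Fin d) (Fin d) ℂ, Commute a (algebraMap ℂ _ l) := fun a =>
    (Algebra.commutes l a).symm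
  set A := s + n - algebraMap ℂ _ l with hA
  have hAn : Commute A n := by
    refine Commute.sub_left (Commute.add_left hc (Commute.refl n)) (hcl n).symm
  have key : ((s - algebraMap ℂ _ l) ^ (N + k)).mulVec v = 0 := by
    have e1 : s - algebraMap ℂ _ l = A + (-n) := by rw [hA]; abel
    rw [e1, (hAn.neg_right).add_pow', Matrix.sum_mulVec]
    refine Finset.sum_eq_zero fun m hm => ?_
    rw [Finset.HasAntidiagonal.mem_antidiagonal] at hm
    rw [Matrix.smul_mulVec]
    by_cases hN : N ≤ m.1
    · obtain ⟨c, hc'⟩ := Nat.exists_eq_add_of_le hN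
      rw [((hAn.neg_right).pow_pow _ _).eq, hc', add_comm N c, pow_add, ← mul_assoc,
        ← Matrix.mulVec_mulVec, h]
      simp
    · have : (-n) ^ m.2 = 0 := by
        rw [neg_pow, pow_eq_zero_of_le (by omega : k ≤ m.2) hk, mul_zero]
      simp [this]
  obtain ⟨g, D, hD⟩ := hs
  have e2 : s - algebraMap ℂ _ l = (g : Matrix (Fin d) (Fin d) ℂ) *
      Matrix.diagonal (fun i => D i - l) * ((g⁻¹ : (Matrix (Fin d) (Fin d) ℂ)ˣ) : Matrix (Fin d) (Fin d) ℂ) := by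
    have : Matrix.diagonal (fun i => D i - l) = Matrix.diagonal D - algebraMap ℂ (Matrix (Fin d) (Fin d) ℂ) l := by
      ext i j
      by_cases hij : i = j <;> simp [hij, Matrix.algebraMap_matrix_apply]
    rw [this, mul_sub, sub_mul, ← hD, (hcl _).eq, mul_assoc (algebraMap ℂ _ l)]
    simp
  have hz : ∀ M, (s - algebraMap ℂ _ l) ^ M = (g : Matrix (Fin d) (Fin d) ℂ) *
      Matrix.diagonal (fun i => D i - l) ^ M * ((g⁻¹ : (Matrix (Fin d) (Fin d) ℂ)ˣ) : Matrix (Fin d) (Fin d) ℂ) := by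
    intro M; rw [e2, Units.conj_pow]
  rw [hz, mul_assoc, ← Matrix.mulVec_mulVec] at key
  have k2 := congrArg (fun w => ((g⁻¹ : (Matrix (Fin d) (Fin d) ℂ)ˣ) : Matrix (Fin d) (Fin d) ℂ).mulVec w) key
  simp only [Matrix.mulVec_mulVec, Units.inv_mul_cancel_left, Matrix.mulVec_zero] at k2
  rw [← Matrix.mulVec_mulVec, Matrix.diagonal_pow] at k2
  have k3 : (Matrix.diagonal (fun i => D i - l)).mulVec (((g⁻¹ : (Matrix (Fin d) (Fin d) ℂ)ˣ) : Matrix (Fin d) (Fin d) ℂ).mulVec v) = 0 := by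
    ext i
    have := congrFun k2 i
    rw [Matrix.mulVec_diagonal] at this ⊢
    simp only [Pi.pow_apply, Pi.zero_apply, mul_eq_zero] at this ⊢
    exact this.imp_left eq_zero_of_pow_eq_zero
  have k4 : (s - algebraMap ℂ _ l).mulVec v = 0 := by
    rw [e2, mul_assoc, ← Matrix.mulVec_mulVec, ← Matrix.mulVec_mulVec, k3, Matrix.mulVec_zero]
  rw [Matrix.sub_mulVec, sub_eq_zero] at k4
  rw [k4, Algebra.algebraMap_eq_smul_one, Matrix.smul_mulVec, Matrix.one_mulVec]

theorem stmt18 (d : ℕ) (φ s n : Matrix (Fin d) (Fin d) ℂ)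
    (hφ : φ = s + n)
    (hs : ∃ g : (Matrix (Fin d) (Fin d) ℂ)ˣ, ∃ D : Fin d → ℂ,
      s = (g : Matrix (Fin d) (Fin d) ℂ) * Matrix.diagonal D *
        ((g⁻¹ : (Matrix (Fin d) (Fin d) ℂ)ˣ) : Matrix (Fin d) (Fin d) ℂ))
    (hn : IsNilpotent n) (hc : s * n = n * s) :
    (∀ t : ℂ, t ≠ 0 → ∃ g : (Matrix (Fin d) (Fin d) ℂ)ˣ,
      s + t • n = (g : Matrix (Fin d) (Fin d) ℂ) * φ *
        ((g⁻¹ : (Matrix (Fin d) (Fin d) ℂ)ˣ) : Matrix (Fin d) (Fin d) ℂ)) ∧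
    s ∈ closure {ψ : Matrix (Fin d) (Fin d) ℂ |
      ∃ g : (Matrix (Fin d) (Fin d) ℂ)ˣ,
        ψ = (g : Matrix (Fin d) (Fin d) ℂ) * φ *
          ((g⁻¹ : (Matrix (Fin d) (Fin d) ℂ)ˣ) : Matrix (Fin d) (Fin d) ℂ)} := by
  have main : ∀ t : ℂ, t ≠ 0 → ∃ g : (Matrix (Fin d) (Fin d) ℂ)ˣ,
      s + t • n = (g : Matrix (Fin d) (Fin d) ℂ) * φ *
        ((g⁻¹ : (Matrix (Fin d) (Fin d) ℂ)ˣ) : Matrix (Fin d) (Fin d) ℂ) := by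
    intro t ht
    let T : Matrix (Fin d) (Fin d) ℂ ≃ₐ[ℂ] Module.End ℂ (Fin d → ℂ) := Matrix.toLinAlgEquiv'
    have hT : ∀ A v, T A v = A.mulVec v := fun A v => Matrix.toLinAlgEquiv'_apply A v
    obtain ⟨g, hg⟩ := conj_aux (T φ) (T s) (T n) (by rw [hφ, map_add]) (by
      intro l N v h
      rw [hT]
      refine diag_aux d s n hs hn hc l N v ?_
      rw [← hT, map_pow, map_sub, ← hφ, AlgEquiv.commutes]
      exact h) t ht
    let u : (Module.End ℂ (Fin d → ℂ))ˣ := ⟨g.toLinearMap, g.symm.toLinearMap, by ext; simp, by ext; simp⟩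
    let w := Units.map (T.symm : Module.End ℂ (Fin d → ℂ) →* Matrix (Fin d) (Fin d) ℂ) u
    refine ⟨w, ?_⟩
    rw [Units.eq_mul_inv_iff_mul_eq]
    apply T.injective
    have hw : T (w : Matrix (Fin d) (Fin d) ℂ) = g.toLinearMap := T.apply_symm_apply _
    rw [map_mul, map_mul, hw, map_add, map_smul]
    exact LinearMap.ext fun v => (hg v).symm
  refine ⟨main, ?_⟩
  have hlim : Filter.Tendsto (fun t : ℂ => s + t • n) (nhdsWithin 0 {0}ᶜ) (nhds s) := by
    have : Continuous (fun t : ℂ => s + t • n) := by fun_prop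
    have h := this.tendsto 0
    simp only [zero_smul, add_zero] at h
    exact h.mono_left nhdsWithin_le_nhds
  refine mem_closure_of_tendsto hlim ?_
  filter_upwards [self_mem_nhdsWithin] with t ht
  exact main t ht
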